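/- arXiv:2108.04764 — 2 statements merged into one kernel-verified Lean document; each statement's English description precedes it below -/
import Mathlib

section
/- The butterfly network BF(2) has no edge-forcing set; that is, no set of pairwise independent edges of BF(2) has endpoint set whose zero-forcing closure is the entire vertex set. -/
open SimpleGraph

/-- Zero-forcing closure: `ZFForced G S v` means `v` is eventually forced
starting from the initially-forced set `S`. A forced vertex `u` whose neighbors,
with the single exception of `v`, are all forced, forces `v`. -/
inductive ZFForced {V : Type*} (G : SimpleGraph V) (S : Set V) : V → Prop
  | init {v : V} : v ∈ S → ZFForced G S v
  | force {u v : V} : ZFForced G S u → G.Adj u v →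
      (∀ w, G.Adj u w → w ≠ v → ZFForced G S w) → ZFForced G S v

/-- `S` is a zero forcing set of `G` if its closure is all of `V`. -/
def IsZeroForcingSet {V : Type*} (G : SimpleGraph V) (S : Set V) : Prop :=
  ∀ v : V, ZFForced G S v

/-- `K` is an edge-forcing set of `G`: a set of pairwise non-adjacent
(vertex-disjoint) edges of `G` whose endpoint set is a zero forcing set. -/
def IsEdgeForcingSet {V : Type*} (G : SimpleGraph V) (K : Set (Sym2 V)) : Prop :=
  K ⊆ G.edgeSet ∧
  K.Pairwise (fun e f => ∀ v : V, v ∈ e → v ∉ f) ∧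
  IsZeroForcingSet G {v : V | ∃ e ∈ K, v ∈ e}

/-- The edge-forcing number: minimum cardinality of an edge-forcing set. -/
noncomputable def edgeForcingNumber {V : Type*} (G : SimpleGraph V) : ℕ :=
  sInf {n : ℕ | ∃ K : Set (Sym2 V), IsEdgeForcingSet G K ∧ K.ncard = n}

/-- The `r`-dimensional butterfly network: vertices `(w, i)` with
`w : Fin r → Bool` and level `i : Fin (r+1)`; `(w,i)` is adjacent to `(w',i+1)`
iff `w = w'` or `w` and `w'` differ exactly in bit `i+1` (index `i`, 0-based). -/
def butterfly (r : ℕ) : SimpleGraph ((Fin r → Bool) × Fin (r + 1)) :=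
  SimpleGraph.fromRel (fun p q =>
    (p.2 : ℕ) + 1 = (q.2 : ℕ) ∧
      (p.1 = q.1 ∨ ∀ k : Fin r, (p.1 k ≠ q.1 k ↔ (k : ℕ) = (p.2 : ℕ))))

/-- A fort `F` disjoint from `S` is never reached by the forcing process. -/
theorem fort_not_forced {V : Type*} (G : SimpleGraph V) (S F : Set V)
    (hS : ∀ v ∈ F, v ∉ S)
    (hF : ∀ u, u ∉ F → ∀ v ∈ F, G.Adj u v → ∃ w ∈ F, w ≠ v ∧ G.Adj u w)
    (v : V) (h : ZFForced G S v) : v ∉ F := by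
  induction h with
  | init hv => exact fun hF => hS _ hF hv
  | force _ hadj _ ihu ihw =>
    intro hv
    obtain ⟨w, hw, hne, ha⟩ := hF _ ihu _ hv hadj
    exact ihw w ha hne hw

abbrev BV : Type := (Fin 2 → Bool) × Fin 3

instance bfDec (p q : BV) : Decidable ((butterfly 2).Adj p q) :=
  decidable_of_iff _ (SimpleGraph.fromRel_adj _ p q).symm

/-- The twin of a vertex on an outer level (level 0 or 2). -/
def twin (v : BV) : BV :=
  (fun k => if (k = 0 ↔ v.2 = 0) then !(v.1 k) else v.1 k, v.2)

theorem twin_twin : ∀ v : BV, twin (twin v) = v := by decide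
theorem twin_ne : ∀ v : BV, twin v ≠ v := by decide
theorem twin_lev : ∀ v : BV, (twin v).2 = v.2 := by decide
theorem adj_lev : ∀ u v : BV, (butterfly 2).Adj u v → (u.2 ≠ 1 ↔ v.2 = 1) := by decide
theorem adj_twin : ∀ u v : BV, (butterfly 2).Adj u v → v.2 ≠ 1 →
    (butterfly 2).Adj u (twin v) := by decide
theorem adj_other : ∀ u v : BV, (butterfly 2).Adj u v → v.2 ≠ 1 →
    ∃ w : BV, w.2 ≠ 1 ∧ w ≠ v ∧ twin w ≠ v ∧ (butterfly 2).Adj u w := by decide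
theorem card_outer : (Finset.univ.filter (fun v : BV => v.2 ≠ 1)).card = 8 := by decide
theorem card_mid : (Finset.univ.filter (fun v : BV => v.2 = 1)).card = 4 := by decide

theorem no_edgeForcingSet_BF2 :
    ¬ ∃ K : Set (Sym2 ((Fin 2 → Bool) × Fin 3)), IsEdgeForcingSet (butterfly 2) K := by
  classical
  rintro ⟨K, hK, hP, hZ⟩
  set S : Set BV := {v | ∃ e ∈ K, v ∈ e} with hSdef
  let O : Finset BV := Finset.univ.filter (fun v => v.2 ≠ 1 ∧ v ∈ S)
  have memO : ∀ v, v ∈ O ↔ v.2 ≠ 1 ∧ v ∈ S := by simp [O]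
  -- every selected outer vertex is matched to its own middle vertex
  have hm : ∀ v : BV, ∃ u : BV, v ∈ O → s(v, u) ∈ K ∧ u.2 = 1 := by
    intro v
    by_cases hv : v ∈ O
    · obtain ⟨h1, e, he, hve⟩ := (memO v).1 hv
      obtain ⟨u, rfl⟩ := hve
      exact ⟨u, fun _ => ⟨he, (adj_lev v u (hK he)).1 h1⟩⟩
    · exact ⟨v, fun h => absurd h hv⟩
  choose f hf using hm
  have hcard : O.card ≤ 4 := by
    rw [← card_mid]
    refine Finset.card_le_card_of_injOn f ?_ ?_
    · intro v hv
      simpa using (hf v hv).2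
    · intro v hv v' hv' heq
      have h1 := (hf v hv).1
      have h2 := (hf v' hv').1
      rw [← heq] at h2
      by_contra hne
      refine hP h1 h2 ?_ (f v) (Sym2.mem_mk_right _ _) (Sym2.mem_mk_right _ _)
      intro h
      exact hne (Sym2.congr_left.1 h)
  -- each twin pair is a fort
  have hhit : ∀ v : BV, v.2 ≠ 1 → v ∈ O ∨ twin v ∈ O := by
    intro v hv
    by_contra hcon
    rw [not_or, memO, memO, twin_lev] at hcon
    refine fort_not_forced (butterfly 2) S {v, twin v} ?_ ?_ v (hZ v) (by simp)
    · rintro x (rfl | rfl) hx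
      · exact hcon.1 ⟨hv, hx⟩
      · exact hcon.2 ⟨hv, hx⟩
    · rintro u - x (rfl | rfl) ha
      · exact ⟨twin x, by simp, twin_ne x, adj_twin u x ha hv⟩
      · refine ⟨v, by simp, (twin_ne v).symm, ?_⟩
        have := adj_twin u _ ha (by rw [twin_lev]; exact hv)
        rwa [twin_twin] at this
  -- by counting, no twin pair is selected entirely
  have hone : ∀ v ∈ O, twin v ∉ O := by
    intro v hv hv'
    have hsub : Finset.univ.filter (fun v : BV => v.2 ≠ 1) ⊆ O ∪ (O.erase v).image twin := by
      intro x hx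
      have hx' : x.2 ≠ 1 := by simpa using hx
      by_cases hxO : x ∈ O
      · exact Finset.mem_union_left _ hxO
      · have h2 := (hhit x hx').resolve_left hxO
        refine Finset.mem_union_right _ (Finset.mem_image.2 ⟨twin x, ?_, twin_twin x⟩)
        refine Finset.mem_erase.2 ⟨?_, h2⟩
        intro h
        rw [← h, twin_twin] at hv'
        exact hxO hv'
    have h1 := Finset.card_le_card hsub
    have h2 := Finset.card_union_le O ((O.erase v).image twin)
    have h3 : ((O.erase v).image twin).card ≤ (O.erase v).card := Finset.card_image_le
    have h4 := Finset.card_erase_lt_of_mem hv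
    rw [card_outer] at h1
    omega
  -- the unselected outer vertices form a fort
  have hfort := fort_not_forced (butterfly 2) S {v | v.2 ≠ 1 ∧ v ∉ O}
    (fun v hv hS => hv.2 ((memO v).2 ⟨hv.1, hS⟩))
    (by
      rintro u - v ⟨hv, -⟩ ha
      obtain ⟨w, hw, hwv, htw, haw⟩ := adj_other u v ha hv
      by_cases hwO : w ∈ O
      · exact ⟨twin w, ⟨by rw [twin_lev]; exact hw, hone w hwO⟩, htw, adj_twin u w haw hw⟩
      · exact ⟨w, ⟨hw, hwO⟩, hwv, haw⟩)
  let z : BV := (fun _ => false, 0)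
  have hz : z.2 ≠ 1 := by decide
  by_cases hzO : z ∈ O
  · exact hfort (twin z) (hZ _) ⟨by rw [twin_lev]; exact hz, hone z hzO⟩
  · exact hfort z (hZ _) ⟨hz, hzO⟩
end

section
/- Every edge-forcing set of the 4-dimensional butterfly network BF(4) has cardinality at least 25. -/
open SimpleGraph

namespace BF4

abbrev W := Fin 4 → Bool
abbrev V := W × Fin 5
abbrev I := (Bool × Bool × Bool) ⊕ (Bool × Bool × Bool) ⊕ (Fin 3 × Fin 3)

def flip (k : Fin 4) (w : W) : W := fun j => if j = k then !(w j) else w j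

/-- The `0`-`1` value of a Boolean in `ZMod 2`. -/
def b2 (b : Bool) : ZMod 2 := if b then 1 else 0

/-- Level two part of a basis vector: a rectangle in the `4 × 4` array indexed by the first
two and the last two bits. -/
def isIdx (r : Fin 3) (x y : Bool) : Bool :=
  match x, y with
  | false, false => true
  | true, false => r == 0
  | false, true => r == 1
  | true, true => r == 2

def cv (r s : Fin 3) (w : W) : Bool := isIdx r (w 0) (w 1) && isIdx s (w 2) (w 3)

/-- Basis vectors of a 25-dimensional space of null vectors of the adjacency matrix over
`ZMod 2`, supported on even levels. -/
def basB : I → V → Bool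
  | .inl (a, b, c), (w, l) => l == 0 && w 1 == a && w 2 == b && w 3 == c
  | .inr (.inl (a, b, c)), (w, l) => l == 4 && w 0 == a && w 1 == b && w 2 == c
  | .inr (.inr (r, s)), (w, l) =>
    if l = 0 then !(w 0) && (xor (cv r s w) (cv r s (flip 1 w)))
    else if l = 2 then cv r s w
    else if l = 4 then !(w 3) && (xor (cv r s w) (cv r s (flip 2 w)))
    else false

def bas (i : I) (v : V) : ZMod 2 := b2 (basB i v)

/-- Information set. -/
def info : I → V
  | .inl (a, b, c) => (![true, a, b, c], 0)
  | .inr (.inl (a, b, c)) => (![a, b, c, true], 4)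
  | .inr (.inr (r, s)) => (![r != 1, r != 0, s != 1, s != 0], 2)

def odd (v : V) : Bool := v.2 == 1 || v.2 == 3

def nb (u : V) : Finset V :=
  if u.2 = 1 then {(u.1, 0), (flip 0 u.1, 0), (u.1, 2), (flip 1 u.1, 2)}
  else {(u.1, 2), (flip 2 u.1, 2), (u.1, 4), (flip 3 u.1, 4)}

lemma bas_odd : ∀ i v, odd v = true → bas i v = 0 := by
  decide +kernel

lemma bas_info : ∀ i j, bas i (info j) = if i = j then 1 else 0 := by
  decide +kernel

lemma bas_sum : ∀ i u, odd u = true → ∑ w ∈ nb u, bas i w = 0 := by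
  decide +kernel

instance : DecidableRel (butterfly 4).Adj := fun a b => by
  unfold butterfly
  simp only [SimpleGraph.fromRel_adj]
  infer_instance

lemma mem_nb : ∀ u w : V, odd u = true → (w ∈ nb u ↔ (butterfly 4).Adj u w) := by
  decide +kernel

lemma adj_odd : ∀ u w : V, (butterfly 4).Adj u w → odd w = !(odd u) := by
  decide +kernel

/-- Linear combination of the basis vectors. -/
def comb : (I → ZMod 2) →ₗ[ZMod 2] (V → ZMod 2) where
  toFun a v := ∑ i, a i * bas i v
  map_add' a b := by
    ext v; simp [add_mul, Finset.sum_add_distrib]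
  map_smul' c a := by
    ext v; simp only [Pi.smul_apply, smul_eq_mul, RingHom.id_apply, Finset.mul_sum, mul_assoc]

lemma comb_apply (a : I → ZMod 2) (v : V) : comb a v = ∑ i, a i * bas i v := rfl

lemma comb_odd (a : I → ZMod 2) (v : V) (h : odd v = true) : comb a v = 0 := by
  rw [comb_apply]
  exact Finset.sum_eq_zero fun i _ => by rw [bas_odd i v h, mul_zero]

lemma comb_info (a : I → ZMod 2) (j : I) : comb a (info j) = a j := by
  simp [comb_apply, bas_info]

lemma comb_sum (a : I → ZMod 2) (u : V) (h : odd u = true) : ∑ w ∈ nb u, comb a w = 0 := by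
  simp only [comb_apply]
  rw [Finset.sum_comm]
  refine Finset.sum_eq_zero fun i _ => ?_
  rw [← Finset.mul_sum, bas_sum i u h, mul_zero]

/-- Null vectors vanishing on `S` vanish on everything forced by `S`. -/
lemma comb_forced (a : I → ZMod 2) (S : Set V) (hS : ∀ v ∈ S, comb a v = 0) (v : V)
    (h : ZFForced (butterfly 4) S v) : comb a v = 0 := by
  induction h with
  | init hv => exact hS _ hv
  | @force u v _ huv _ _ ih =>
    by_cases hu : odd u = true
    · have h1 := comb_sum a u hu
      rwa [Finset.sum_eq_single v] at h1
      · intro w hw hne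
        exact ih w ((mem_nb u w hu).1 hw) hne
      · intro hn
        exact absurd ((mem_nb u v hu).2 huv) hn
    · apply comb_odd
      rw [adj_odd u v huv]
      simpa using hu

lemma even_end (e : Sym2 V) (he : e ∈ (butterfly 4).edgeSet) :
    ∃ v : V, ∀ w ∈ e, w = v ∨ odd w = true := by
  induction e using Sym2.ind with
  | _ x y =>
    rw [SimpleGraph.mem_edgeSet] at he
    have h := adj_odd x y he
    by_cases hx : odd x = true
    · refine ⟨y, fun w hw => ?_⟩
      rcases Sym2.mem_iff.1 hw with rfl | rfl
      · exact Or.inr hx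
      · exact Or.inl rfl
    · refine ⟨x, fun w hw => ?_⟩
      rcases Sym2.mem_iff.1 hw with rfl | rfl
      · exact Or.inl rfl
      · right
        rw [h]; simpa using hx

end BF4

theorem edgeForcing_BF4_lower_bound
    (K : Set (Sym2 ((Fin 4 → Bool) × Fin 5)))
    (hK : IsEdgeForcingSet (butterfly 4) K) :
    25 ≤ K.ncard := by
  obtain ⟨hE, -, hZ⟩ := hK
  classical
  have hex : ∀ e : K, ∃ v : BF4.V, ∀ w ∈ (e : Sym2 BF4.V), w = v ∨ BF4.odd w = true :=
    fun e => BF4.even_end e.1 (hE e.2)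
  choose f hf using hex
  haveI : Fintype K := Fintype.ofFinite K
  let Φ : (BF4.I → ZMod 2) →ₗ[ZMod 2] (K → ZMod 2) :=
    (LinearMap.funLeft (ZMod 2) (ZMod 2) f).comp BF4.comb
  have hΦ : Function.Injective Φ := by
    rw [injective_iff_map_eq_zero]
    intro a ha
    have hS : ∀ v ∈ {v : BF4.V | ∃ e ∈ K, v ∈ e}, BF4.comb a v = 0 := by
      rintro v ⟨e, he, hv⟩
      rcases hf ⟨e, he⟩ v hv with h | h
      · rw [h]
        exact congrFun ha ⟨e, he⟩
      · exact BF4.comb_odd a v h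
    ext j
    rw [← BF4.comb_info a j]
    exact BF4.comb_forced a _ hS _ (hZ _)
  have h := LinearMap.finrank_le_finrank_of_injective hΦ
  rw [Module.finrank_fintype_fun_eq_card, Module.finrank_fintype_fun_eq_card] at h
  have h25 : Fintype.card BF4.I = 25 := by simp
  rw [h25] at h
  rwa [← Nat.card_coe_set_eq, Nat.card_eq_fintype_card]
end
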